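/- arXiv:2105.03871 — 2 statements merged into one kernel-verified Lean document; each statement's English description precedes it below -/
import Mathlib

section
/- Let v = 1/√(27+15√3), so that the complementary modulus is v' = √(1−v²) = 1/√(27−15√3). Then the ratio 6K(v)/K(v') lies in the interval [2.79957467136936 − 8.4·10⁻¹⁵, 2.79957467136936 + 8.4·10⁻¹⁵]. -/
open MeasureTheory

/-- The complete elliptic integral of the first kind `K(k)`. -/
noncomputable def ellK (k : ℝ) : ℝ :=
  ∫ t in (0:ℝ)..1, 1 / Real.sqrt ((1 - t ^ 2) * (1 - k ^ 2 * t ^ 2))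

/-- The integral `∫₀^∞ dx / √((x² + a²)(x² + b²))`, invariant under the arithmetic-geometric
mean step. -/
noncomputable def agmIntegral (a b : ℝ) : ℝ :=
  ∫ x in Set.Ioi (0 : ℝ), 1 / Real.sqrt ((x ^ 2 + a ^ 2) * (x ^ 2 + b ^ 2))

theorem image_inv_sqrt_one_add_sq_Ioi :
    (fun y : ℝ => 1 / Real.sqrt (1 + y ^ 2)) '' Set.Ioi 0 = Set.Ioo 0 1 := by
  ext t
  simp only [Set.mem_image, Set.mem_Ioi, Set.mem_Ioo]
  constructor
  · rintro ⟨y, hy, rfl⟩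
    have h : 1 < Real.sqrt (1 + y ^ 2) := by
      rw [Real.lt_sqrt (by norm_num)]
      nlinarith [pow_pos hy 2]
    exact ⟨by positivity, by rw [div_lt_one (by positivity)]; exact h⟩
  · rintro ⟨h0, h1⟩
    have h : 0 < 1 - t ^ 2 := by nlinarith
    refine ⟨Real.sqrt (1 - t ^ 2) / t, div_pos (Real.sqrt_pos.2 h) h0, ?_⟩
    have h2 : 1 + (Real.sqrt (1 - t ^ 2) / t) ^ 2 = (1 / t) ^ 2 := by
      rw [div_pow, Real.sq_sqrt h.le]
      field_simp
      ring
    rw [h2, Real.sqrt_sq (by positivity), one_div_one_div]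

theorem injOn_inv_sqrt_one_add_sq_Ioi :
    Set.InjOn (fun y : ℝ => 1 / Real.sqrt (1 + y ^ 2)) (Set.Ioi 0) := by
  intro x hx y hy hxy
  simp only [one_div, inv_inj] at hxy
  rw [Real.sqrt_inj (by positivity) (by positivity)] at hxy
  exact (pow_left_inj₀ (le_of_lt hx) (le_of_lt hy) two_ne_zero).1 (by linarith)

theorem hasDerivAt_inv_sqrt_one_add_sq (y : ℝ) :
    HasDerivAt (fun y : ℝ => 1 / Real.sqrt (1 + y ^ 2))
      (-(y / (Real.sqrt (1 + y ^ 2) * (1 + y ^ 2)))) y := by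
  have hp : 0 < 1 + y ^ 2 := by positivity
  have h1 : HasDerivAt (fun y : ℝ => 1 + y ^ 2) (2 * y) y := by
    simpa using (hasDerivAt_pow 2 y).const_add 1
  have h2 := (h1.sqrt hp.ne').inv (Real.sqrt_pos.2 hp).ne'
  have h3 := Real.sqrt_pos.2 hp
  have h4 : -(2 * y / (2 * Real.sqrt (1 + y ^ 2))) / Real.sqrt (1 + y ^ 2) ^ 2
      = -(y / (Real.sqrt (1 + y ^ 2) * (1 + y ^ 2))) := by
    rw [Real.sq_sqrt hp.le]
    field_simp
  rw [h4] at h2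
  exact h2.congr_of_eventuallyEq (Filter.Eventually.of_forall fun y => one_div _)

/-- The complete elliptic integral as an integral over the half-line, with `b` the complementary
modulus. -/
theorem ellK_eq_agmIntegral {k b : ℝ} (hk : k ^ 2 + b ^ 2 = 1) :
    ellK k = agmIntegral 1 b := by
  rw [ellK, intervalIntegral.integral_of_le zero_le_one, integral_Ioc_eq_integral_Ioo,
    ← image_inv_sqrt_one_add_sq_Ioi,
    integral_image_eq_integral_abs_deriv_smul measurableSet_Ioi
      (fun y _ => (hasDerivAt_inv_sqrt_one_add_sq y).hasDerivWithinAt)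
      injOn_inv_sqrt_one_add_sq_Ioi, agmIntegral]
  refine setIntegral_congr_fun measurableSet_Ioi fun y hy => ?_
  have hy : 0 < y := hy
  have hp : 0 < 1 + y ^ 2 := by positivity
  have hs := Real.sqrt_pos.2 hp
  have h1 : (1 - (1 / Real.sqrt (1 + y ^ 2)) ^ 2) * (1 - k ^ 2 * (1 / Real.sqrt (1 + y ^ 2)) ^ 2)
      = (y / (Real.sqrt (1 + y ^ 2)) ^ 2) ^ 2 * (y ^ 2 + b ^ 2) := by
    have hb : k ^ 2 = 1 - b ^ 2 := by linarith
    rw [div_pow, Real.sq_sqrt hp.le, hb]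
    field_simp
    ring
  have h2 : (y ^ 2 + 1 ^ 2) * (y ^ 2 + b ^ 2)
      = (Real.sqrt (1 + y ^ 2)) ^ 2 * (y ^ 2 + b ^ 2) := by
    rw [Real.sq_sqrt hp.le]
    ring
  have h3 : 0 < Real.sqrt (y ^ 2 + b ^ 2) := Real.sqrt_pos.2 (by positivity)
  simp only [smul_eq_mul]
  rw [h1, h2, Real.sqrt_mul (by positivity), Real.sqrt_mul (by positivity),
    Real.sqrt_sq (by positivity), Real.sqrt_sq hs.le, abs_neg, abs_of_pos (by positivity),
    Real.sq_sqrt hp.le]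
  field_simp

theorem image_gauss_Ioi {c : ℝ} (hc : 0 < c) :
    (fun x : ℝ => (x - c / x) / 2) '' Set.Ioi 0 = Set.univ := by
  refine Set.eq_univ_of_forall fun u => ?_
  have h1 : |u| < Real.sqrt (u ^ 2 + c) := by
    rw [Real.lt_sqrt (abs_nonneg u), sq_abs]
    linarith
  have h2 : 0 < u + Real.sqrt (u ^ 2 + c) := by linarith [neg_abs_le u]
  refine ⟨u + Real.sqrt (u ^ 2 + c), h2, ?_⟩
  have h3 : Real.sqrt (u ^ 2 + c) ^ 2 = u ^ 2 + c := Real.sq_sqrt (by positivity)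
  field_simp
  linear_combination h3

theorem injOn_gauss_Ioi {c : ℝ} (hc : 0 < c) :
    Set.InjOn (fun x : ℝ => (x - c / x) / 2) (Set.Ioi 0) := by
  refine StrictMonoOn.injOn fun x hx y _ hxy => ?_
  have := div_lt_div_of_pos_left hc hx hxy
  have hxy : x < y := hxy
  change (x - c / x) / 2 < (y - c / y) / 2
  linarith

theorem hasDerivAt_gauss (c : ℝ) {x : ℝ} (hx : x ≠ 0) :
    HasDerivAt (fun x : ℝ => (x - c / x) / 2) ((1 + c / x ^ 2) / 2) x := by
  have h := ((hasDerivAt_id x).sub ((hasDerivAt_inv hx).const_mul c)).div_const 2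
  have h1 : (1 - c * -(x ^ 2)⁻¹) / 2 = (1 + c / x ^ 2) / 2 := by ring
  rw [h1] at h
  exact h

/-- Gauss's invariance of the integral under the arithmetic-geometric mean step. -/
theorem agmIntegral_mean {a b : ℝ} (ha : 0 < a) (hb : 0 < b) :
    agmIntegral ((a + b) / 2) (Real.sqrt (a * b)) = agmIntegral a b := by
  set f : ℝ → ℝ := fun u =>
    1 / Real.sqrt ((u ^ 2 + ((a + b) / 2) ^ 2) * (u ^ 2 + Real.sqrt (a * b) ^ 2)) with hf
  have hc : 0 < a * b := mul_pos ha hb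
  have h1 : ∫ u, f u = 2 * agmIntegral ((a + b) / 2) (Real.sqrt (a * b)) := by
    rw [agmIntegral, ← integral_comp_abs (f := f)]
    simp only [hf, sq_abs]
  have h2 : ∫ u, f u = 2 * agmIntegral a b := by
    rw [← setIntegral_univ (μ := volume) (f := f), ← image_gauss_Ioi hc,
      integral_image_eq_integral_abs_deriv_smul measurableSet_Ioi
        (fun x hx => (hasDerivAt_gauss (a * b) (ne_of_gt hx)).hasDerivWithinAt)
        (injOn_gauss_Ioi hc), agmIntegral, ← integral_const_mul]
    refine setIntegral_congr_fun measurableSet_Ioi fun x hx => ?_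
    have hx : 0 < x := hx
    have h3 : (((x - a * b / x) / 2) ^ 2 + ((a + b) / 2) ^ 2) *
        (((x - a * b / x) / 2) ^ 2 + a * b) =
        ((x + a * b / x) / (4 * x)) ^ 2 * ((x ^ 2 + a ^ 2) * (x ^ 2 + b ^ 2)) := by
      field_simp
      ring
    have h4 : 0 < Real.sqrt ((x ^ 2 + a ^ 2) * (x ^ 2 + b ^ 2)) :=
      Real.sqrt_pos.2 (by positivity)
    simp only [hf, smul_eq_mul]
    rw [Real.sq_sqrt hc.le, h3, Real.sqrt_mul (by positivity), Real.sqrt_sq (by positivity),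
      abs_of_pos (by positivity)]
    field_simp
    ring
  linarith

theorem integrableOn_one_div_sq_add_sq {a : ℝ} (ha : 0 < a) :
    IntegrableOn (fun x : ℝ => 1 / (x ^ 2 + a ^ 2)) (Set.Ioi 0) := by
  have h := (integrable_inv_one_add_sq.comp_div ha.ne').const_mul (1 / a ^ 2)
  refine (h.congr (Filter.Eventually.of_forall fun x => ?_)).integrableOn
  have : 0 < x ^ 2 + a ^ 2 := by positivity
  have : 0 < 1 + (x / a) ^ 2 := by positivity
  field_simp
  ring

theorem agmIntegral_self {a : ℝ} (ha : 0 < a) : agmIntegral a a = Real.pi / (2 * a) := by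
  have h := integral_comp_mul_left_Ioi (fun x : ℝ => (1 + x ^ 2)⁻¹) 0 (inv_pos.2 ha)
  rw [mul_zero, integral_Ioi_inv_one_add_sq, Real.arctan_zero, sub_zero, inv_inv] at h
  calc agmIntegral a a
      = ∫ x in Set.Ioi (0 : ℝ), 1 / a ^ 2 * (1 + (a⁻¹ * x) ^ 2)⁻¹ := by
        refine setIntegral_congr_fun measurableSet_Ioi fun x _ => ?_
        have h1 : 0 < x ^ 2 + a ^ 2 := by positivity
        have : 0 < 1 + (a⁻¹ * x) ^ 2 := by positivity
        rw [Real.sqrt_mul_self h1.le]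
        field_simp
        ring
    _ = Real.pi / (2 * a) := by
        rw [integral_const_mul, h, smul_eq_mul]
        field_simp

theorem integrableOn_agmIntegral {a b : ℝ} (ha : 0 < a) (hb : 0 < b) :
    IntegrableOn (fun x : ℝ => 1 / Real.sqrt ((x ^ 2 + a ^ 2) * (x ^ 2 + b ^ 2)))
      (Set.Ioi 0) := by
  have hm : 0 < min a b := lt_min ha hb
  refine (integrableOn_one_div_sq_add_sq hm).mono'
    (Measurable.aestronglyMeasurable (by fun_prop))
    (Filter.Eventually.of_forall fun x => ?_)
  rw [Real.norm_of_nonneg (by positivity)]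
  refine one_div_le_one_div_of_le (by positivity) (Real.le_sqrt_of_sq_le ?_)
  rw [sq (x ^ 2 + _)]
  gcongr
  · exact min_le_left a b
  · exact min_le_right a b

theorem agmIntegral_anti {a b c d : ℝ} (ha : 0 < a) (hb : 0 < b) (hac : a ≤ c) (hbd : b ≤ d) :
    agmIntegral c d ≤ agmIntegral a b := by
  refine setIntegral_mono_on (integrableOn_agmIntegral (ha.trans_le hac) (hb.trans_le hbd))
    (integrableOn_agmIntegral ha hb) measurableSet_Ioi fun x _ => ?_
  gcongr

theorem agmIntegral_le_step {a b c d : ℝ} (hc : 0 < c) (hd : 0 < d) (ha : 0 < a) (hb : 0 < b)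
    (h1 : c ≤ (a + b) / 2) (h2 : d ^ 2 ≤ a * b) : agmIntegral a b ≤ agmIntegral c d := by
  rw [← agmIntegral_mean ha hb]
  exact agmIntegral_anti hc hd h1 (Real.le_sqrt_of_sq_le h2)

theorem agmIntegral_step_le {a b c d : ℝ} (ha : 0 < a) (hb : 0 < b) (hd : 0 < d)
    (h1 : (a + b) / 2 ≤ c) (h2 : a * b ≤ d ^ 2) : agmIntegral c d ≤ agmIntegral a b := by
  rw [← agmIntegral_mean ha hb]
  exact agmIntegral_anti (by positivity) (by positivity) h1 (Real.sqrt_le_iff.2 ⟨hd.le, h2⟩)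

theorem agmIntegral_one_le_of_modulus_le {b : ℝ} (hb : 0.137385500236785770161243 ≤ b) :
    agmIntegral 1 b ≤ Real.pi / (2 * 0.464380932795244547860722) :=
  calc agmIntegral 1 b ≤ agmIntegral 1 0.137385500236785770161243 :=
        agmIntegral_anti (by norm_num) (by norm_num) le_rfl hb
    _ ≤ agmIntegral 0.568692750118392885080621 0.370655500750745327666289 := by
        apply agmIntegral_le_step <;> norm_num
    _ ≤ agmIntegral 0.469674125434569106373455 0.459117736608434023418868 := by
        apply agmIntegral_le_step <;> norm_num
    _ ≤ agmIntegral 0.464395931021501564896161 0.464365934811184337899339 := by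
        apply agmIntegral_le_step <;> norm_num
    _ ≤ agmIntegral 0.464380932916342951397750 0.464380932674146144355274 := by
        apply agmIntegral_le_step <;> norm_num
    _ ≤ agmIntegral 0.464380932795244547876512 0.464380932795244547860722 := by
        apply agmIntegral_le_step <;> norm_num
    _ ≤ agmIntegral 0.464380932795244547860722 0.464380932795244547860722 := by
        apply agmIntegral_anti <;> norm_num
    _ = Real.pi / (2 * 0.464380932795244547860722) := agmIntegral_self (by norm_num)

theorem le_agmIntegral_one_of_le_modulus {b : ℝ} (h0 : 0 < b)
    (hb : b ≤ 0.137385500236785770161245) :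
    Real.pi / (2 * 0.464380932795244547876518) ≤ agmIntegral 1 b :=
  calc Real.pi / (2 * 0.464380932795244547876518)
      = agmIntegral 0.464380932795244547876518 0.464380932795244547876518 :=
        (agmIntegral_self (by norm_num)).symm
    _ ≤ agmIntegral 0.464380932795244547876518 0.464380932795244547860728 := by
        apply agmIntegral_anti <;> norm_num
    _ ≤ agmIntegral 0.464380932916342951397755 0.464380932674146144355280 := by
        apply agmIntegral_step_le <;> norm_num
    _ ≤ agmIntegral 0.464395931021501564896165 0.464365934811184337899344 := by
        apply agmIntegral_step_le <;> norm_num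
    _ ≤ agmIntegral 0.469674125434569106373458 0.459117736608434023418872 := by
        apply agmIntegral_step_le <;> norm_num
    _ ≤ agmIntegral 0.568692750118392885080623 0.370655500750745327666292 := by
        apply agmIntegral_step_le <;> norm_num
    _ ≤ agmIntegral 1 0.137385500236785770161245 := by
        apply agmIntegral_step_le <;> norm_num
    _ ≤ agmIntegral 1 b := agmIntegral_anti one_pos h0 le_rfl hb

theorem agmIntegral_one_le_of_compl_modulus_le {b : ℝ} (hb : 0.990517654726400188200633 ≤ b) :
    agmIntegral 1 b ≤ Real.pi / (2 * 0.995253180872868154807074) :=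
  calc agmIntegral 1 b ≤ agmIntegral 1 0.990517654726400188200633 :=
        agmIntegral_anti (by norm_num) (by norm_num) le_rfl hb
    _ ≤ agmIntegral 0.995258827363200094100316 0.995247534398553628589944 := by
        apply agmIntegral_le_step <;> norm_num
    _ ≤ agmIntegral 0.995253180880876861345130 0.995253180864859448269083 := by
        apply agmIntegral_le_step <;> norm_num
    _ ≤ agmIntegral 0.995253180872868154807106 0.995253180872868154807074 := by
        apply agmIntegral_le_step <;> norm_num
    _ ≤ agmIntegral 0.995253180872868154807074 0.995253180872868154807074 := by
        apply agmIntegral_anti <;> norm_num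
    _ = Real.pi / (2 * 0.995253180872868154807074) := agmIntegral_self (by norm_num)

theorem le_agmIntegral_one_of_le_compl_modulus {b : ℝ} (h0 : 0 < b)
    (hb : b ≤ 0.990517654726400188200634) :
    Real.pi / (2 * 0.995253180872868154807108) ≤ agmIntegral 1 b :=
  calc Real.pi / (2 * 0.995253180872868154807108)
      = agmIntegral 0.995253180872868154807108 0.995253180872868154807108 :=
        (agmIntegral_self (by norm_num)).symm
    _ ≤ agmIntegral 0.995253180872868154807108 0.995253180872868154807076 := by
        apply agmIntegral_anti <;> norm_num
    _ ≤ agmIntegral 0.995253180880876861345131 0.995253180864859448269085 := by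
        apply agmIntegral_step_le <;> norm_num
    _ ≤ agmIntegral 0.995258827363200094100317 0.995247534398553628589945 := by
        apply agmIntegral_step_le <;> norm_num
    _ ≤ agmIntegral 1 0.990517654726400188200634 := by
        apply agmIntegral_step_le <;> norm_num
    _ ≤ agmIntegral 1 b := agmIntegral_anti one_pos h0 le_rfl hb

/-- For `v = 1/√(27+15√3)` and `v' = 1/√(27−15√3)`, the extremal length `6K(v)/K(v')`
of a face curve lies in `[2.79957467136936 ± 8.4·10⁻¹⁵]`. -/
theorem face_curve_value :
    6 * ellK (1 / Real.sqrt (27 + 15 * Real.sqrt 3))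
        / ellK (1 / Real.sqrt (27 - 15 * Real.sqrt 3))
      ∈ Set.Icc ((2.79957467136936 : ℝ) - 8.4 * 10 ^ (-15 : ℤ))
          ((2.79957467136936 : ℝ) + 8.4 * 10 ^ (-15 : ℤ)) := by
  have hs2 : Real.sqrt 3 ^ 2 = 3 := Real.sq_sqrt (by norm_num)
  have hsl : 1.732050807568877293527446 ≤ Real.sqrt 3 := Real.le_sqrt_of_sq_le (by norm_num)
  have hsu : Real.sqrt 3 ≤ 1.732050807568877293527447 :=
    Real.sqrt_le_iff.2 ⟨by norm_num, by norm_num⟩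
  set s := Real.sqrt 3
  have hp : 0 < 27 + 15 * s := by linarith
  have hm : 0 < 27 - 15 * s := by linarith
  set v := 1 / Real.sqrt (27 + 15 * s)
  set w := 1 / Real.sqrt (27 - 15 * s)
  have hv0 : 0 < v := one_div_pos.2 (Real.sqrt_pos.2 hp)
  have hw0 : 0 < w := one_div_pos.2 (Real.sqrt_pos.2 hm)
  have hv : v ^ 2 = (27 - 15 * s) / 54 := by
    rw [div_pow, Real.sq_sqrt hp.le, div_eq_div_iff hp.ne' (by norm_num)]
    linear_combination 225 * hs2
  have hw : w ^ 2 = (27 + 15 * s) / 54 := by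
    rw [div_pow, Real.sq_sqrt hm.le, div_eq_div_iff hm.ne' (by norm_num)]
    linear_combination 225 * hs2
  have hvl : 0.137385500236785770161243 ≤ v :=
    (sq_le_sq₀ (by norm_num) (by linarith)).1 (by rw [hv]; linarith)
  have hvu : v ≤ 0.137385500236785770161245 :=
    (sq_le_sq₀ (by linarith) (by norm_num)).1 (by rw [hv]; linarith)
  have hwl : 0.990517654726400188200633 ≤ w :=
    (sq_le_sq₀ (by norm_num) (by linarith)).1 (by rw [hw]; linarith)
  have hwu : w ≤ 0.990517654726400188200634 :=
    (sq_le_sq₀ (by linarith) (by norm_num)).1 (by rw [hw]; linarith)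
  rw [ellK_eq_agmIntegral (b := w) (by linarith), ellK_eq_agmIntegral (b := v) (by linarith)]
  have h1 := agmIntegral_one_le_of_modulus_le hvl
  have h2 := le_agmIntegral_one_of_le_modulus hv0 hvu
  have h3 := agmIntegral_one_le_of_compl_modulus_le hwl
  have h4 := le_agmIntegral_one_of_le_compl_modulus hw0 hwu
  have hpi := Real.pi_pos
  have h5 : 0 < agmIntegral 1 v := lt_of_lt_of_le (by positivity) h2
  norm_num at h1 h2 h3 h4
  rw [Set.mem_Icc, le_div_iff₀ h5, div_le_iff₀ h5]
  norm_num
  constructor <;> linarith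
end

section
/- Let w = 2 − √3, so that the complementary modulus is w' = √(1−w²) = √(4√3−6). Then the ratio 4K(w)/K'(w) lies in the interval [2.34031875460627 − 5.71·10⁻¹⁵, 2.34031875460627 + 5.71·10⁻¹⁵]. In particular, 4K(w)/K'(w) < 6K(v)/K'(v) where v = 1/√(27+15√3). -/
open MeasureTheory

/-- The complementary complete elliptic integral `K'(k) = K(√(1-k²))`,
written with modulus squared `1 - k²`. -/
noncomputable def ellK' (k : ℝ) : ℝ :=
  ∫ t in (0:ℝ)..1, 1 / Real.sqrt ((1 - t ^ 2) * (1 - (1 - k ^ 2) * t ^ 2))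

/-- Gauss's integral `∫ dx / √((a² + x²)(b² + x²))` over the real line, which equals
`π / agm(a, b)`. -/
noncomputable def gaussIntegral (a b : ℝ) : ℝ :=
  ∫ x : ℝ, 1 / Real.sqrt ((a ^ 2 + x ^ 2) * (b ^ 2 + x ^ 2))

theorem integral_Ioi_eq_half_gaussIntegral (a b : ℝ) :
    ∫ x in Set.Ioi (0 : ℝ), 1 / Real.sqrt ((a ^ 2 + x ^ 2) * (b ^ 2 + x ^ 2))
      = gaussIntegral a b / 2 := by
  have h := integral_comp_abs
    (f := fun x : ℝ => 1 / Real.sqrt ((a ^ 2 + x ^ 2) * (b ^ 2 + x ^ 2)))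
  simp only [sq_abs] at h
  rw [gaussIntegral, h]
  ring

/-- Invariance of Gauss's integral under the arithmetic-geometric mean step, by the substitution
`u = (t - ab / t) / 2`. -/
theorem gaussIntegral_mean {a b : ℝ} (ha : 0 < a) (hb : 0 < b) :
    gaussIntegral ((a + b) / 2) (Real.sqrt (a * b)) = gaussIntegral a b := by
  have hab : 0 < a * b := mul_pos ha hb
  have hinj : Set.InjOn (fun t : ℝ => (t - a * b / t) / 2) (Set.Ioi 0) := by
    intro s hs t ht h
    have hs : 0 < s := hs
    have ht : 0 < t := ht
    have h : (s - a * b / s) / 2 = (t - a * b / t) / 2 := h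
    have h2 : (s - t) * (s * t + a * b) = 0 := by
      field_simp at h
      linear_combination h
    rcases mul_eq_zero.mp h2 with h3 | h3
    · linarith
    · have := mul_pos hs ht
      linarith
  have himg : (fun t : ℝ => (t - a * b / t) / 2) '' Set.Ioi 0 = Set.univ := by
    refine Set.eq_univ_of_forall fun u => ?_
    have hs : Real.sqrt (u ^ 2 + a * b) ^ 2 = u ^ 2 + a * b := Real.sq_sqrt (by positivity)
    have hlt : |u| < Real.sqrt (u ^ 2 + a * b) := by
      rw [← Real.sqrt_sq_eq_abs]
      exact Real.sqrt_lt_sqrt (sq_nonneg u) (by linarith)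
    have hpos : 0 < u + Real.sqrt (u ^ 2 + a * b) := by
      linarith [neg_abs_le u]
    refine ⟨u + Real.sqrt (u ^ 2 + a * b), hpos, ?_⟩
    have hne := hpos.ne'
    field_simp
    linear_combination hs
  have hderiv : ∀ t ∈ Set.Ioi (0 : ℝ), HasDerivWithinAt (fun t : ℝ => (t - a * b / t) / 2)
      ((1 + a * b / t ^ 2) / 2) (Set.Ioi 0) t := by
    intro t ht
    have ht : t ≠ 0 := ne_of_gt ht
    have h := (((hasDerivAt_id' t).sub ((hasDerivAt_inv ht).const_mul (a * b))).div_const 2)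
    refine HasDerivAt.hasDerivWithinAt (h.congr_deriv ?_)
    field_simp
    ring
  have h := integral_image_eq_integral_abs_deriv_smul measurableSet_Ioi hderiv hinj
    (fun u => 1 / Real.sqrt ((((a + b) / 2) ^ 2 + u ^ 2) * (Real.sqrt (a * b) ^ 2 + u ^ 2)))
  rw [himg, Measure.restrict_univ] at h
  rw [gaussIntegral, h]
  have h2 : gaussIntegral a b = ∫ x in Set.Ioi (0 : ℝ),
      2 * (1 / Real.sqrt ((a ^ 2 + x ^ 2) * (b ^ 2 + x ^ 2))) := by
    rw [integral_const_mul, integral_Ioi_eq_half_gaussIntegral]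
    ring
  rw [h2]
  refine setIntegral_congr_fun measurableSet_Ioi fun t ht => ?_
  have ht : 0 < t := ht
  have key : (((a + b) / 2) ^ 2 + ((t - a * b / t) / 2) ^ 2)
        * (Real.sqrt (a * b) ^ 2 + ((t - a * b / t) / 2) ^ 2)
      = ((t ^ 2 + a * b) / (4 * t ^ 2)) ^ 2 * ((a ^ 2 + t ^ 2) * (b ^ 2 + t ^ 2)) := by
    rw [Real.sq_sqrt hab.le]
    field_simp
    ring
  have hpos : 0 < Real.sqrt ((a ^ 2 + t ^ 2) * (b ^ 2 + t ^ 2)) := by positivity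
  simp only [smul_eq_mul]
  rw [key, Real.sqrt_mul (by positivity), Real.sqrt_sq (by positivity),
    abs_of_pos (by positivity)]
  field_simp
  ring

theorem integrable_one_div_sq_add_sq {a : ℝ} (ha : 0 < a) :
    Integrable fun x : ℝ => 1 / (a ^ 2 + x ^ 2) := by
  have h := (integrable_inv_one_add_sq.comp_mul_left' (inv_ne_zero ha.ne')).const_mul (a ^ 2)⁻¹
  convert h using 2 with x
  field_simp

theorem integral_univ_one_div_sq_add_sq {a : ℝ} (ha : 0 < a) :
    ∫ x : ℝ, 1 / (a ^ 2 + x ^ 2) = Real.pi / a := by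
  have h := Measure.integral_comp_mul_left (fun x : ℝ => (1 + x ^ 2)⁻¹) a⁻¹
  rw [integral_univ_inv_one_add_sq, inv_inv, abs_of_pos ha, smul_eq_mul] at h
  have h2 : (fun x : ℝ => 1 / (a ^ 2 + x ^ 2))
      = fun x => (a ^ 2)⁻¹ * (1 + (a⁻¹ * x) ^ 2)⁻¹ := by
    funext x
    field_simp
  rw [h2, integral_const_mul, h]
  field_simp

theorem one_div_sqrt_le_of_le {a b m : ℝ} (hm : 0 < m) (ha : m ≤ a) (hb : m ≤ b) (x : ℝ) :
    1 / Real.sqrt ((a ^ 2 + x ^ 2) * (b ^ 2 + x ^ 2)) ≤ 1 / (m ^ 2 + x ^ 2) := by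
  refine one_div_le_one_div_of_le (by positivity) (Real.le_sqrt_of_sq_le ?_)
  rw [sq]
  gcongr

theorem integrable_gaussIntegral {a b : ℝ} (ha : 0 < a) (hb : 0 < b) :
    Integrable fun x : ℝ => 1 / Real.sqrt ((a ^ 2 + x ^ 2) * (b ^ 2 + x ^ 2)) := by
  have hm : 0 < min a b := lt_min ha hb
  refine (integrable_one_div_sq_add_sq hm).mono' ?_ (Filter.Eventually.of_forall fun x => ?_)
  · refine Continuous.aestronglyMeasurable (continuous_const.div (by fun_prop) fun x => ?_)
    positivity
  · rw [Real.norm_of_nonneg (by positivity)]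
    exact one_div_sqrt_le_of_le hm (min_le_left a b) (min_le_right a b) x

theorem gaussIntegral_anti {a a₁ b b₁ : ℝ} (ha : 0 < a) (haa : a ≤ a₁) (hb : 0 < b)
    (hbb : b ≤ b₁) : gaussIntegral a₁ b₁ ≤ gaussIntegral a b := by
  refine integral_mono (integrable_gaussIntegral (ha.trans_le haa) (hb.trans_le hbb))
    (integrable_gaussIntegral ha hb) fun x => ?_
  refine one_div_le_one_div_of_le (by positivity) (Real.sqrt_le_sqrt ?_)
  gcongr

theorem gaussIntegral_self {m : ℝ} (hm : 0 < m) : gaussIntegral m m = Real.pi / m := by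
  rw [← integral_univ_one_div_sq_add_sq hm, gaussIntegral]
  refine integral_congr_ae (Filter.Eventually.of_forall fun x => ?_)
  simp only
  rw [Real.sqrt_mul_self (by positivity)]

theorem gaussIntegral_le_pi_div {a b m : ℝ} (hm : 0 < m) (ha : m ≤ a) (hb : m ≤ b) :
    gaussIntegral a b ≤ Real.pi / m :=
  (gaussIntegral_anti hm ha hm hb).trans_eq (gaussIntegral_self hm)

theorem pi_div_le_gaussIntegral {a b m : ℝ} (ha : 0 < a) (hb : 0 < b) (ham : a ≤ m)
    (hbm : b ≤ m) : Real.pi / m ≤ gaussIntegral a b :=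
  (gaussIntegral_self (ha.trans_le ham)).symm.trans_le (gaussIntegral_anti ha ham hb hbm)

theorem le_gaussIntegral_mean {a b a₁ b₁ : ℝ} (ha : 0 < a) (hb : 0 < b) (ha₁ : 0 < a₁)
    (hb₁ : 0 < b₁) (h : a₁ ≤ (a + b) / 2) (hsq : b₁ ^ 2 ≤ a * b) :
    gaussIntegral a b ≤ gaussIntegral a₁ b₁ := by
  rw [← gaussIntegral_mean ha hb]
  exact gaussIntegral_anti ha₁ h hb₁ (Real.le_sqrt_of_sq_le hsq)

theorem gaussIntegral_mean_le {a b a₁ b₁ : ℝ} (ha : 0 < a) (hb : 0 < b) (hb₁ : 0 ≤ b₁)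
    (h : (a + b) / 2 ≤ a₁) (hsq : a * b ≤ b₁ ^ 2) :
    gaussIntegral a₁ b₁ ≤ gaussIntegral a b := by
  rw [← gaussIntegral_mean ha hb]
  exact gaussIntegral_anti (by positivity) h (Real.sqrt_pos.mpr (mul_pos ha hb))
    (Real.sqrt_le_left hb₁ |>.mpr hsq)

/-- The Legendre form of the complete elliptic integral in terms of Gauss's integral, by the
substitution `t = x / √(x² + c²)`. -/
theorem integral_legendre_eq_half_gaussIntegral {c m : ℝ} (hc : 0 < c) (hm : m = 1 - c ^ 2) :
    ∫ t in (0 : ℝ)..1, 1 / Real.sqrt ((1 - t ^ 2) * (1 - m * t ^ 2))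
      = gaussIntegral 1 c / 2 := by
  have hsq (x : ℝ) : Real.sqrt (x ^ 2 + c ^ 2) ^ 2 = x ^ 2 + c ^ 2 :=
    Real.sq_sqrt (by positivity)
  have hpos (x : ℝ) : 0 < Real.sqrt (x ^ 2 + c ^ 2) := by positivity
  have hleft : Set.LeftInvOn (fun t : ℝ => c * t / Real.sqrt (1 - t ^ 2))
      (fun x : ℝ => x / Real.sqrt (x ^ 2 + c ^ 2)) (Set.Ioi 0) := by
    intro x _
    have h1 : 1 - (x / Real.sqrt (x ^ 2 + c ^ 2)) ^ 2
        = (c / Real.sqrt (x ^ 2 + c ^ 2)) ^ 2 := by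
      rw [div_pow, div_pow, hsq]
      field_simp
      ring
    have := hpos x
    simp only
    rw [h1, Real.sqrt_sq (by positivity)]
    field_simp
  have himg : (fun x : ℝ => x / Real.sqrt (x ^ 2 + c ^ 2)) '' Set.Ioi 0 = Set.Ioo 0 1 := by
    ext t
    constructor
    · rintro ⟨x, hx, rfl⟩
      have hx : 0 < x := hx
      have := hpos x
      refine ⟨by positivity, (div_lt_one this).mpr (Real.lt_sqrt_of_sq_lt ?_)⟩
      nlinarith
    · rintro ⟨h0, h1⟩
      have h2 : 0 < 1 - t ^ 2 := by nlinarith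
      have h3 : 0 < Real.sqrt (1 - t ^ 2) := Real.sqrt_pos.mpr h2
      have h4 : (c * t / Real.sqrt (1 - t ^ 2)) ^ 2 + c ^ 2
          = (c / Real.sqrt (1 - t ^ 2)) ^ 2 := by
        rw [div_pow, div_pow, Real.sq_sqrt h2.le]
        field_simp
        ring
      refine ⟨c * t / Real.sqrt (1 - t ^ 2), by simp only [Set.mem_Ioi]; positivity, ?_⟩
      simp only
      rw [h4, Real.sqrt_sq (by positivity)]
      field_simp
  have hderiv : ∀ x ∈ Set.Ioi (0 : ℝ),
      HasDerivWithinAt (fun x : ℝ => x / Real.sqrt (x ^ 2 + c ^ 2))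
        (c ^ 2 / Real.sqrt (x ^ 2 + c ^ 2) ^ 3) (Set.Ioi 0) x := by
    intro x _
    have hp : HasDerivAt (fun x : ℝ => x ^ 2 + c ^ 2) (2 * x) x := by
      simpa using (hasDerivAt_pow 2 x).add_const (c ^ 2)
    have h := (hasDerivAt_id' x).div (hp.sqrt (by positivity)) (hpos x).ne'
    refine HasDerivAt.hasDerivWithinAt (h.congr_deriv ?_)
    have := hpos x
    have h5 := hsq x
    field_simp
    linear_combination h5
  have h := integral_image_eq_integral_abs_deriv_smul measurableSet_Ioi hderiv hleft.injOn
    (fun t => 1 / Real.sqrt ((1 - t ^ 2) * (1 - m * t ^ 2)))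
  rw [intervalIntegral.integral_of_le zero_le_one, integral_Ioc_eq_integral_Ioo, ← himg, h,
    ← integral_Ioi_eq_half_gaussIntegral]
  refine setIntegral_congr_fun measurableSet_Ioi fun x _ => ?_
  have hx := hpos x
  have key : (1 - (x / Real.sqrt (x ^ 2 + c ^ 2)) ^ 2)
        * (1 - m * (x / Real.sqrt (x ^ 2 + c ^ 2)) ^ 2)
      = (c ^ 2 / Real.sqrt (x ^ 2 + c ^ 2) ^ 3) ^ 2
        * ((1 ^ 2 + x ^ 2) * (c ^ 2 + x ^ 2)) := by
    rw [hm, div_pow, div_pow, ← pow_mul (Real.sqrt _), mul_comm 3 2,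
      pow_mul (Real.sqrt _), hsq]
    field_simp
    ring
  have hpos' : 0 < Real.sqrt ((1 ^ 2 + x ^ 2) * (c ^ 2 + x ^ 2)) := by positivity
  simp only [smul_eq_mul]
  rw [key, Real.sqrt_mul (by positivity), Real.sqrt_sq (by positivity),
    abs_of_pos (by positivity)]
  field_simp

theorem ellK_eq_half_gaussIntegral {k c : ℝ} (hc : 0 < c) (h : k ^ 2 + c ^ 2 = 1) :
    ellK k = gaussIntegral 1 c / 2 :=
  integral_legendre_eq_half_gaussIntegral hc (by linarith)

theorem ellK'_eq_half_gaussIntegral {k : ℝ} (hk : 0 < k) :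
    ellK' k = gaussIntegral 1 k / 2 :=
  integral_legendre_eq_half_gaussIntegral hk rfl

theorem mul_ellK_div_ellK' (n : ℝ) {k c : ℝ} (hk : 0 < k) (hc : 0 < c)
    (h : k ^ 2 + c ^ 2 = 1) :
    n * ellK k / ellK' k = n * (gaussIntegral 1 c / gaussIntegral 1 k) := by
  rw [ellK_eq_half_gaussIntegral hc h, ellK'_eq_half_gaussIntegral hk, mul_div_assoc,
    div_div_div_cancel_right₀ two_ne_zero]

theorem gaussIntegral_div_le {a b c d m M : ℝ} (hM : 0 < M) (h : gaussIntegral a b ≤ Real.pi / m)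
    (h' : Real.pi / M ≤ gaussIntegral c d) :
    gaussIntegral a b / gaussIntegral c d ≤ M / m := by
  have hp := Real.pi_pos
  have hpos : 0 < gaussIntegral c d := (by positivity : 0 < Real.pi / M).trans_le h'
  have h0 : 0 ≤ gaussIntegral a b := integral_nonneg fun x => by positivity
  calc gaussIntegral a b / gaussIntegral c d ≤ (Real.pi / m) / (Real.pi / M) := by
        gcongr
        exact h0.trans h
    _ = M / m := by field_simp

theorem le_gaussIntegral_div {a b c d m M : ℝ} (hm : 0 < m) (hc : 0 < gaussIntegral c d)
    (h : Real.pi / m ≤ gaussIntegral a b) (h' : gaussIntegral c d ≤ Real.pi / M) (hM : 0 < M) :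
    M / m ≤ gaussIntegral a b / gaussIntegral c d := by
  have hp := Real.pi_pos
  calc M / m = (Real.pi / m) / (Real.pi / M) := by field_simp
    _ ≤ gaussIntegral a b / gaussIntegral c d := by
        gcongr
        exact (by positivity : 0 ≤ Real.pi / m).trans h

theorem gaussIntegral_one_two_sub_sqrt_three_le {c : ℝ} (hc : 0.267949192431122706472553 ≤ c) :
    gaussIntegral 1 c ≤ Real.pi / 0.574332585075749493703567 := by
  refine (gaussIntegral_anti one_pos le_rfl (by norm_num) hc).trans ?_
  refine (le_gaussIntegral_mean (a₁ := 0.633974596215561353236276) (b₁ := 0.517638090205041524697797)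
    (by norm_num) (by norm_num) (by norm_num) (by norm_num) (by norm_num) (by norm_num)).trans ?_
  refine (le_gaussIntegral_mean (a₁ := 0.575806343210301438967036) (b₁ := 0.572860715378123589651083)
    (by norm_num) (by norm_num) (by norm_num) (by norm_num) (by norm_num) (by norm_num)).trans ?_
  refine (le_gaussIntegral_mean (a₁ := 0.574333529294212514309059) (b₁ := 0.574331640858062632936656)
    (by norm_num) (by norm_num) (by norm_num) (by norm_num) (by norm_num) (by norm_num)).trans ?_
  refine (le_gaussIntegral_mean (a₁ := 0.574332585076137573622857) (b₁ := 0.574332585075361413784279)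
    (by norm_num) (by norm_num) (by norm_num) (by norm_num) (by norm_num) (by norm_num)).trans ?_
  refine (le_gaussIntegral_mean (a₁ := 0.574332585075749493703568) (b₁ := 0.574332585075749493703567)
    (by norm_num) (by norm_num) (by norm_num) (by norm_num) (by norm_num) (by norm_num)).trans ?_
  exact gaussIntegral_le_pi_div (by norm_num) (by norm_num) (by norm_num)

theorem le_gaussIntegral_one_two_sub_sqrt_three {c : ℝ} (hc0 : 0 < c) (hc : c ≤ 0.267949192431122706472554) :
    Real.pi / 0.574332585075749493703573 ≤ gaussIntegral 1 c := by
  refine le_trans ?_ (gaussIntegral_anti one_pos le_rfl hc0 hc)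
  refine le_trans ?_ (gaussIntegral_mean_le (a₁ := 0.633974596215561353236277) (b₁ := 0.517638090205041524697799)
    (by norm_num) (by norm_num) (by norm_num) (by norm_num) (by norm_num))
  refine le_trans ?_ (gaussIntegral_mean_le (a₁ := 0.575806343210301438967038) (b₁ := 0.572860715378123589651086)
    (by norm_num) (by norm_num) (by norm_num) (by norm_num) (by norm_num))
  refine le_trans ?_ (gaussIntegral_mean_le (a₁ := 0.574333529294212514309062) (b₁ := 0.574331640858062632936660)
    (by norm_num) (by norm_num) (by norm_num) (by norm_num) (by norm_num))
  refine le_trans ?_ (gaussIntegral_mean_le (a₁ := 0.574332585076137573622861) (b₁ := 0.574332585075361413784284)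
    (by norm_num) (by norm_num) (by norm_num) (by norm_num) (by norm_num))
  refine le_trans ?_ (gaussIntegral_mean_le (a₁ := 0.574332585075749493703573) (b₁ := 0.574332585075749493703573)
    (by norm_num) (by norm_num) (by norm_num) (by norm_num) (by norm_num))
  exact pi_div_le_gaussIntegral (by norm_num) (by norm_num) (by norm_num) (by norm_num)

theorem gaussIntegral_one_compl_le {c : ℝ} (hc : 0.963433044002285181174344 ≤ c) :
    gaussIntegral 1 c ≤ Real.pi / 0.981631384947601987466719 := by
  refine (gaussIntegral_anti one_pos le_rfl (by norm_num) hc).trans ?_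
  refine (le_gaussIntegral_mean (a₁ := 0.981716522001142590587172) (b₁ := 0.981546251585876711698169)
    (by norm_num) (by norm_num) (by norm_num) (by norm_num) (by norm_num) (by norm_num)).trans ?_
  refine (le_gaussIntegral_mean (a₁ := 0.981631386793509651142670) (b₁ := 0.981631383101694327261905)
    (by norm_num) (by norm_num) (by norm_num) (by norm_num) (by norm_num) (by norm_num)).trans ?_
  refine (le_gaussIntegral_mean (a₁ := 0.981631384947601989202287) (b₁ := 0.981631384947601987466719)
    (by norm_num) (by norm_num) (by norm_num) (by norm_num) (by norm_num) (by norm_num)).trans ?_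
  exact gaussIntegral_le_pi_div (by norm_num) (by norm_num) (by norm_num)

theorem le_gaussIntegral_one_compl {c : ℝ} (hc0 : 0 < c) (hc : c ≤ 0.963433044002285181174345) :
    Real.pi / 0.981631384947601989202290 ≤ gaussIntegral 1 c := by
  refine le_trans ?_ (gaussIntegral_anti one_pos le_rfl hc0 hc)
  refine le_trans ?_ (gaussIntegral_mean_le (a₁ := 0.981716522001142590587173) (b₁ := 0.981546251585876711698171)
    (by norm_num) (by norm_num) (by norm_num) (by norm_num) (by norm_num))
  refine le_trans ?_ (gaussIntegral_mean_le (a₁ := 0.981631386793509651142672) (b₁ := 0.981631383101694327261907)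
    (by norm_num) (by norm_num) (by norm_num) (by norm_num) (by norm_num))
  refine le_trans ?_ (gaussIntegral_mean_le (a₁ := 0.981631384947601989202290) (b₁ := 0.981631384947601987466722)
    (by norm_num) (by norm_num) (by norm_num) (by norm_num) (by norm_num))
  exact pi_div_le_gaussIntegral (by norm_num) (by norm_num) (by norm_num) (by norm_num)

theorem gaussIntegral_one_le_of_le {c : ℝ} (hc : 0.13 ≤ c) :
    gaussIntegral 1 c ≤ Real.pi / 0.44 := by
  refine (gaussIntegral_anti one_pos le_rfl (by norm_num) hc).trans ?_
  refine (le_gaussIntegral_mean (a₁ := 0.565) (b₁ := 0.36)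
    (by norm_num) (by norm_num) (by norm_num) (by norm_num) (by norm_num) (by norm_num)).trans ?_
  refine (le_gaussIntegral_mean (a₁ := 0.46) (b₁ := 0.44)
    (by norm_num) (by norm_num) (by norm_num) (by norm_num) (by norm_num) (by norm_num)).trans ?_
  exact gaussIntegral_le_pi_div (by norm_num) (by norm_num) (by norm_num)

theorem lt_six_mul_ellK_div_ellK' :
    2.5 < 6 * ellK (1 / Real.sqrt (27 + 15 * Real.sqrt 3))
      / ellK' (1 / Real.sqrt (27 + 15 * Real.sqrt 3)) := by
  have h3 : Real.sqrt 3 ≤ 1.8 := (Real.sqrt_le_left (by norm_num)).mpr (by norm_num)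
  set v := 1 / Real.sqrt (27 + 15 * Real.sqrt 3) with hv
  have hv2 : v ^ 2 = 1 / (27 + 15 * Real.sqrt 3) := by
    rw [hv, div_pow, Real.sq_sqrt (by positivity), one_pow]
  have hv0 : 0 < v := by positivity
  have hlo : 0.13 ≤ v := by
    refine (sq_le_sq₀ (by norm_num) hv0.le).mp ?_
    rw [hv2, le_div_iff₀ (by positivity)]
    nlinarith
  have hlt : v ^ 2 < 1 := by
    rw [hv2, div_lt_one (by positivity)]
    linarith [Real.sqrt_nonneg 3]
  have hc0 : 0 < Real.sqrt (1 - v ^ 2) := Real.sqrt_pos.mpr (by linarith)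
  have hc1 : Real.sqrt (1 - v ^ 2) ≤ 1 := Real.sqrt_le_one.mpr (by linarith [sq_nonneg v])
  rw [mul_ellK_div_ellK' 6 hv0 hc0 (by rw [Real.sq_sqrt (by linarith)]; ring)]
  have h := le_gaussIntegral_div one_pos
    ((div_pos Real.pi_pos one_pos).trans_le
      (pi_div_le_gaussIntegral one_pos hv0 le_rfl (by nlinarith)))
    (pi_div_le_gaussIntegral one_pos hc0 le_rfl hc1) (gaussIntegral_one_le_of_le hlo)
    (by norm_num)
  norm_num at h ⊢
  linarith

theorem four_mul_ellK_div_ellK'_mem_Icc :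
    4 * ellK (2 - Real.sqrt 3) / ellK' (2 - Real.sqrt 3)
        ∈ Set.Icc ((2.34031875460627 : ℝ) - 5.71 * 10 ^ (-15 : ℤ))
            ((2.34031875460627 : ℝ) + 5.71 * 10 ^ (-15 : ℤ)) := by
  have hs : Real.sqrt 3 ^ 2 = 3 := Real.sq_sqrt (by norm_num)
  have h3l : 1.7320508075688772935274463415 ≤ Real.sqrt 3 := Real.le_sqrt_of_sq_le (by norm_num)
  have h3u : Real.sqrt 3 ≤ 1.7320508075688772935274463416 :=
    (Real.sqrt_le_left (by norm_num)).mpr (by norm_num)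
  have hw0 : 0 < 2 - Real.sqrt 3 := by linarith
  have hc2 : Real.sqrt (4 * Real.sqrt 3 - 6) ^ 2 = 4 * Real.sqrt 3 - 6 :=
    Real.sq_sqrt (by linarith)
  have hc0 : 0 < Real.sqrt (4 * Real.sqrt 3 - 6) := Real.sqrt_pos.mpr (by linarith)
  rw [mul_ellK_div_ellK' 4 hw0 hc0 (by rw [hc2]; linear_combination hs)]
  have hwL := gaussIntegral_one_two_sub_sqrt_three_le (c := 2 - Real.sqrt 3) (by linarith)
  have hwU := le_gaussIntegral_one_two_sub_sqrt_three hw0 (by linarith)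
  have hcL := gaussIntegral_one_compl_le (c := Real.sqrt (4 * Real.sqrt 3 - 6))
    (Real.le_sqrt_of_sq_le (by norm_num; linarith))
  have hcU := le_gaussIntegral_one_compl hc0
    ((Real.sqrt_le_left (by norm_num)).mpr (by norm_num; linarith))
  have hu := gaussIntegral_div_le (by norm_num) hcL hwU
  have hl := le_gaussIntegral_div (by norm_num)
    ((div_pos Real.pi_pos (by norm_num)).trans_le hwU) hcU hwL (by norm_num)
  constructor
  · refine le_trans ?_ (mul_le_mul_of_nonneg_left hl (by norm_num))
    norm_num
  · refine (mul_le_mul_of_nonneg_left hu (by norm_num)).trans ?_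
    norm_num

/-- For `w = 2 − √3`, the ratio `4K(w)/K'(w)` lies in
`[2.34031875460627 ± 5.71·10⁻¹⁵]`; in particular it is strictly smaller than
`6K(v)/K'(v)` where `v = 1/√(27+15√3)`. -/
theorem hexagon_double_value :
    (4 * ellK (2 - Real.sqrt 3) / ellK' (2 - Real.sqrt 3)
        ∈ Set.Icc ((2.34031875460627 : ℝ) - 5.71 * 10 ^ (-15 : ℤ))
            ((2.34031875460627 : ℝ) + 5.71 * 10 ^ (-15 : ℤ))) ∧
    4 * ellK (2 - Real.sqrt 3) / ellK' (2 - Real.sqrt 3)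
      < 6 * ellK (1 / Real.sqrt (27 + 15 * Real.sqrt 3))
          / ellK' (1 / Real.sqrt (27 + 15 * Real.sqrt 3)) := by
  refine ⟨four_mul_ellK_div_ellK'_mem_Icc, ?_⟩
  refine four_mul_ellK_div_ellK'_mem_Icc.2.trans_lt (lt_trans ?_ lt_six_mul_ellK_div_ellK')
  norm_num
end
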